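/- Fix 1 ≤ k ≤ n and let A ∈ M_n(ℂ) satisfy: a_{ij} = 0 whenever i ≤ k and (j < i or j > k); a_{ii} ≠ 0 for 1 ≤ i ≤ k; and a_{ij} = 0 for all i > k and all j (so e_i·e_i = ∑_{j=i}^{k} a_{ij} e_j with a_{ii} ≠ 0 for i ≤ k, and e_i·e_i = 0 for i > k). Then a linear map d : E(A) → E(A) is a derivation if and only if d(e_i) = 0 for all 1 ≤ i ≤ k and d(e_i) ∈ span{e_{k+1},…,e_n} for all k+1 ≤ i ≤ n; consequently, the space of derivations Der(E(A)) has dimension (n−k)² over ℂ. -/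

import Mathlib

open Matrix Polynomial Finset

/-- The multiplication of the evolution algebra `E(A)` on `ℂ^n` associated to the
matrix `A`: it is the unique commutative bilinear multiplication with
`e i · e j = 0` for `i ≠ j` and `e i · e i = ∑ k, A i k • e k`, where `e i = Pi.single i 1`
is the standard (natural) basis. -/
noncomputable def evolMul {n : ℕ} (A : Matrix (Fin n) (Fin n) ℂ) (u v : Fin n → ℂ) : Fin n → ℂ :=
  fun k => ∑ i, u i * v i * A i k

/-- A linear map `d : E(A) → E(A)` is a derivation if `d (u·v) = d u · v + u · d v`. -/
def IsEvolDerivation {n : ℕ} (A : Matrix (Fin n) (Fin n) ℂ)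
    (d : (Fin n → ℂ) →ₗ[ℂ] (Fin n → ℂ)) : Prop :=
  ∀ u v : Fin n → ℂ, d (evolMul A u v) = evolMul A (d u) v + evolMul A u (d v)

theorem evolMul_add_left {n : ℕ} (A : Matrix (Fin n) (Fin n) ℂ) (x y v : Fin n → ℂ) :
    evolMul A (x + y) v = evolMul A x v + evolMul A y v := by
  funext p
  simp [evolMul, add_mul, Finset.sum_add_distrib]

theorem evolMul_add_right {n : ℕ} (A : Matrix (Fin n) (Fin n) ℂ) (u x y : Fin n → ℂ) :
    evolMul A u (x + y) = evolMul A u x + evolMul A u y := by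
  funext p
  simp [evolMul, mul_add, add_mul, Finset.sum_add_distrib]

theorem evolMul_smul_left {n : ℕ} (A : Matrix (Fin n) (Fin n) ℂ) (c : ℂ) (x v : Fin n → ℂ) :
    evolMul A (c • x) v = c • evolMul A x v := by
  funext p
  simp [evolMul, Finset.mul_sum, mul_assoc]

theorem evolMul_smul_right {n : ℕ} (A : Matrix (Fin n) (Fin n) ℂ) (c : ℂ) (u x : Fin n → ℂ) :
    evolMul A u (c • x) = c • evolMul A u x := by
  funext p
  simp only [evolMul, Pi.smul_apply, smul_eq_mul, Finset.mul_sum]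
  congr 1
  funext i
  ring

/-- The space `Der(E(A))` of derivations of the evolution algebra `E(A)`, as a complex
linear subspace of the endomorphism space of `ℂ^n`. -/
noncomputable def evolDer {n : ℕ} (A : Matrix (Fin n) (Fin n) ℂ) :
    Submodule ℂ ((Fin n → ℂ) →ₗ[ℂ] (Fin n → ℂ)) where
  carrier := {d | IsEvolDerivation A d}
  zero_mem' := by
    intro u v
    funext p
    simp [evolMul]
  add_mem' := by
    intro d₁ d₂ h₁ h₂ u v
    simp only [LinearMap.add_apply, h₁ u v, h₂ u v, evolMul_add_left, evolMul_add_right]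
    abel
  smul_mem' := by
    intro c d h u v
    simp only [LinearMap.smul_apply, h u v, evolMul_smul_left, evolMul_smul_right,
      smul_add]

theorem linearMap_apply_eq_sum {n : ℕ} (d : (Fin n → ℂ) →ₗ[ℂ] (Fin n → ℂ)) (u : Fin n → ℂ)
    (p : Fin n) : d u p = ∑ i, u i * d (Pi.single i 1) p := by
  conv_lhs => rw [pi_eq_sum_univ' u]
  simp [map_sum, Finset.sum_apply]

theorem evolMul_single_right {n : ℕ} (A : Matrix (Fin n) (Fin n) ℂ) (u : Fin n → ℂ)
    (j p : Fin n) : evolMul A u (Pi.single j 1) p = u j * A j p := by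
  simp [evolMul, Pi.single_apply]

theorem evolMul_single_left {n : ℕ} (A : Matrix (Fin n) (Fin n) ℂ) (u : Fin n → ℂ)
    (j p : Fin n) : evolMul A (Pi.single j 1) u p = u j * A j p := by
  simp [evolMul, Pi.single_apply]

theorem mem_span_single_iff {n : ℕ} (k : ℕ) (v : Fin n → ℂ) :
    v ∈ Submodule.span ℂ {v : Fin n → ℂ | ∃ j : Fin n, k ≤ j.val ∧ v = Pi.single j 1} ↔
      ∀ j : Fin n, j.val < k → v j = 0 := by
  constructor
  · intro hv
    induction hv using Submodule.span_induction with
    | mem x hx =>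
      obtain ⟨i, hi, rfl⟩ := hx
      intro j hj
      exact Pi.single_eq_of_ne (by rintro rfl; omega) _
    | zero => simp
    | add x y _ _ hx hy => intro j hj; simp [hx j hj, hy j hj]
    | smul c x _ hx => intro j hj; simp [hx j hj]
  · intro h
    have hv : v = ∑ j, v j • (Pi.single j (1 : ℂ) : Fin n → ℂ) := by
      funext p
      simp [Finset.sum_apply, Pi.single_apply]
    rw [hv]
    refine Submodule.sum_mem _ fun j _ => ?_
    by_cases hj : j.val < k
    · simp [h j hj]
    · exact Submodule.smul_mem _ _ (Submodule.subset_span ⟨j, not_lt.mp hj, rfl⟩)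

/-- A derivation is supported on the annihilating block: its matrix entries vanish
outside the rows and columns of index at least `k`. -/
theorem IsEvolDerivation.apply_single_eq_zero {n k : ℕ} {A : Matrix (Fin n) (Fin n) ℂ}
    (hA0 : ∀ i j : Fin n, i.val < k → (j.val < i.val ∨ k ≤ j.val) → A i j = 0)
    (hAd : ∀ i : Fin n, i.val < k → A i i ≠ 0)
    (hAz : ∀ i : Fin n, k ≤ i.val → A i = 0)
    {d : (Fin n → ℂ) →ₗ[ℂ] (Fin n → ℂ)} (hd : IsEvolDerivation A d) (i j : Fin n)
    (hij : i.val < k ∨ j.val < k) : d (Pi.single i 1) j = 0 := by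
  have off (i j p : Fin n) (h : i ≠ j) :
      d (Pi.single i 1) j * A j p + d (Pi.single j 1) i * A i p = 0 := by
    have h0 : evolMul A (Pi.single i 1) (Pi.single j 1) = 0 := by
      funext q
      rw [evolMul_single_right]
      simp [Pi.single_eq_of_ne h.symm]
    have := congrFun (hd (Pi.single i 1) (Pi.single j 1)) p
    rw [h0, map_zero, Pi.add_apply, evolMul_single_right, evolMul_single_left] at this
    exact this.symm
  have diag (i p : Fin n) :
      ∑ l, A i l * d (Pi.single l 1) p = 2 * d (Pi.single i 1) i * A i p := by
    have h0 : evolMul A (Pi.single i 1) (Pi.single i 1) = A i := by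
      funext q
      rw [evolMul_single_right]
      simp
    have := congrFun (hd (Pi.single i 1) (Pi.single i 1)) p
    rw [h0, Pi.add_apply, evolMul_single_right, evolMul_single_left,
      linearMap_apply_eq_sum] at this
    rw [this]
    ring
  have low (i j : Fin n) (hi : k ≤ i.val) (hj : j.val < k) : d (Pi.single i 1) j = 0 := by
    have := off i j j (by rintro rfl; omega)
    rw [hAz i hi] at this
    simpa [hAd j hj] using this
  have below (i j : Fin n) (hj : j.val < k) (hji : j.val < i.val) :
      d (Pi.single i 1) j = 0 := by
    rcases lt_or_ge i.val k with hi | hi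
    · have := off i j j (by rintro rfl; omega)
      rw [hA0 i j hi (Or.inl hji)] at this
      simpa [hAd j hj] using this
    · exact low i j hi hj
  have above (i j : Fin n) (hj : j.val < k) (hij : i.val < j.val) :
      d (Pi.single i 1) j = 0 := by
    have := off i j j (by rintro rfl; omega)
    rw [below j i (by omega) hij] at this
    simpa [hAd j hj] using this
  have self (i : Fin n) (hi : i.val < k) : d (Pi.single i 1) i = 0 := by
    have := diag i i
    rw [Finset.sum_eq_single i] at this
    · have h : A i i * d (Pi.single i 1) i = 0 := by linear_combination -this
      exact (mul_eq_zero.mp h).resolve_left (hAd i hi)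
    · intro l _ hl
      rcases lt_or_gt_of_ne (Fin.val_ne_of_ne hl) with h | h
      · rw [hA0 i l hi (Or.inl h), zero_mul]
      · rw [below l i hi h, mul_zero]
    · simp
  have high (m : ℕ) : ∀ i : Fin n, i.val < k → k - i.val = m → k ≤ j.val →
      d (Pi.single i 1) j = 0 := by
    induction m using Nat.strong_induction_on with
    | _ m ih =>
      intro i hi hm hj
      have := diag i j
      rw [self i hi, Finset.sum_eq_single i] at this
      · simpa [hAd i hi] using this
      · intro l _ hl
        by_cases h : l.val < i.val ∨ k ≤ l.val
        · rw [hA0 i l hi h, zero_mul]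
        · have hl' := Fin.val_ne_of_ne hl
          rw [ih (k - l.val) (by omega) l (by omega) rfl hj, mul_zero]
      · simp
  rcases lt_or_ge j.val k with hj | hj
  · rcases lt_trichotomy i.val j.val with h | h | h
    · exact above i j hj h
    · obtain rfl := Fin.ext h
      exact self i hj
    · exact below i j hj h
  · exact high _ i (by omega) rfl hj

theorem isEvolDerivation_of_apply_single_eq_zero {n k : ℕ} {A : Matrix (Fin n) (Fin n) ℂ}
    (hA0 : ∀ i j : Fin n, i.val < k → k ≤ j.val → A i j = 0)
    (hAz : ∀ i : Fin n, k ≤ i.val → A i = 0)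
    {d : (Fin n → ℂ) →ₗ[ℂ] (Fin n → ℂ)}
    (h : ∀ i j : Fin n, i.val < k ∨ j.val < k → d (Pi.single i 1) j = 0) :
    IsEvolDerivation A d := by
  have hdu (u : Fin n → ℂ) (j p : Fin n) : d u j * A j p = 0 := by
    rcases lt_or_ge j.val k with hj | hj
    · rw [linearMap_apply_eq_sum, Finset.sum_eq_zero, zero_mul]
      intro i _
      rw [h i j (Or.inr hj), mul_zero]
    · simp [hAz j hj]
  intro u v
  funext p
  have hl : d (evolMul A u v) p = 0 := by
    rw [linearMap_apply_eq_sum]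
    refine Finset.sum_eq_zero fun i _ => ?_
    rcases lt_or_ge i.val k with hi | hi
    · rw [h i p (Or.inl hi), mul_zero]
    · have : evolMul A u v i = 0 := Finset.sum_eq_zero fun l _ => by
        rcases lt_or_ge l.val k with hl | hl
        · rw [hA0 l i hl hi, mul_zero]
        · simp [hAz l hl]
      rw [this, zero_mul]
  rw [hl, Pi.add_apply]
  have h1 : evolMul A (d u) v p = 0 := Finset.sum_eq_zero fun i _ => by
    linear_combination v i * hdu u i p
  have h2 : evolMul A u (d v) p = 0 := Finset.sum_eq_zero fun i _ => by
    linear_combination u i * hdu v i p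
  rw [h1, h2, add_zero]

theorem finrank_of_mem_iff_apply_single_eq_zero {n k : ℕ}
    (S : Submodule ℂ ((Fin n → ℂ) →ₗ[ℂ] (Fin n → ℂ)))
    (hS : ∀ d, d ∈ S ↔ ∀ i j : Fin n, i.val < k ∨ j.val < k → d (Pi.single i 1) j = 0) :
    Module.finrank ℂ S = (n - k) ^ 2 := by
  let f : S →ₗ[ℂ] Matrix {i : Fin n // k ≤ i.val} {i : Fin n // k ≤ i.val} ℂ :=
    { toFun := fun d i j => d.1 (Pi.single i.1 1) j.1
      map_add' := fun _ _ => rfl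
      map_smul' := fun _ _ => rfl }
  have hf : Function.Bijective f := by
    constructor
    · intro d₁ d₂ h
      refine Subtype.ext (LinearMap.pi_ext' fun i => LinearMap.ext_ring (funext fun j => ?_))
      change d₁.1 (Pi.single i 1) j = d₂.1 (Pi.single i 1) j
      by_cases hij : i.val < k ∨ j.val < k
      · rw [(hS _).mp d₁.2 i j hij, (hS _).mp d₂.2 i j hij]
      · push Not at hij
        exact congrFun (congrFun h ⟨i, hij.1⟩) ⟨j, hij.2⟩
    · intro M
      let N : Matrix (Fin n) (Fin n) ℂ := fun j i =>
        if h : k ≤ i.val ∧ k ≤ j.val then M ⟨i, h.1⟩ ⟨j, h.2⟩ else 0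
      have hN (i j : Fin n) : Matrix.toLin' N (Pi.single i 1) j = N j i := by simp
      refine ⟨⟨Matrix.toLin' N, (hS _).mpr fun i j hij => ?_⟩, ?_⟩
      · rw [hN]
        exact dif_neg (by omega)
      · ext i j
        exact (hN i.1 j.1).trans (dif_pos ⟨i.2, j.2⟩)
  have hc : Fintype.card {i : Fin n // k ≤ i.val} = n - k := by
    have := Fintype.card_subtype_compl (fun i : Fin n => i.val < k)
    simp only [not_lt] at this
    rw [this, Fintype.card_fin, Fintype.card_subtype, Fin.card_filter_val_lt]
    omega
  rw [(LinearEquiv.ofBijective f hf).finrank_eq, Module.finrank_matrix, hc,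
    Module.finrank_self, mul_one, sq]

/-- Let `1 ≤ k ≤ n` and suppose `A` is such that `eᵢ·eᵢ = ∑_{j=i}^{k} aᵢⱼ eⱼ` with
`aᵢᵢ ≠ 0` for `1 ≤ i ≤ k`, while `eᵢ·eᵢ = 0` for `k+1 ≤ i ≤ n`.  Then a linear map `d`
is a derivation of `E(A)` if and only if `d(eᵢ) = 0` for `1 ≤ i ≤ k` and
`d(eᵢ) ∈ span{e_{k+1},…,eₙ}` for `k+1 ≤ i ≤ n`; consequently
`dim Der(E(A)) = (n-k)²`. -/
theorem derivation_iff_block_form_and_finrank (n k : ℕ) (hk1 : 1 ≤ k) (hkn : k ≤ n)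
    (A : Matrix (Fin n) (Fin n) ℂ)
    (hA0 : ∀ i j : Fin n, i.val < k → (j.val < i.val ∨ k ≤ j.val) → A i j = 0)
    (hAd : ∀ i : Fin n, i.val < k → A i i ≠ 0)
    (hAz : ∀ i : Fin n, k ≤ i.val → A i = 0) :
    (∀ d : (Fin n → ℂ) →ₗ[ℂ] (Fin n → ℂ),
      IsEvolDerivation A d ↔
        ((∀ i : Fin n, i.val < k → d (Pi.single i 1) = 0) ∧
          (∀ i : Fin n, k ≤ i.val →
            d (Pi.single i 1) ∈ Submodule.span ℂ
              {v : Fin n → ℂ | ∃ j : Fin n, k ≤ j.val ∧ v = Pi.single j 1}))) ∧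
      Module.finrank ℂ (evolDer A) = (n - k) ^ 2 := by
  have key (d : (Fin n → ℂ) →ₗ[ℂ] (Fin n → ℂ)) : IsEvolDerivation A d ↔
      ∀ i j : Fin n, i.val < k ∨ j.val < k → d (Pi.single i 1) j = 0 :=
    ⟨fun hd => hd.apply_single_eq_zero hA0 hAd hAz,
      isEvolDerivation_of_apply_single_eq_zero (fun i j hi hj => hA0 i j hi (Or.inr hj)) hAz⟩
  refine ⟨fun d => ?_, finrank_of_mem_iff_apply_single_eq_zero _ key⟩
  rw [key]
  simp only [mem_span_single_iff]
  constructor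
  · intro h
    exact ⟨fun i hi => funext fun j => h i j (Or.inl hi), fun i _ j hj => h i j (Or.inr hj)⟩
  · rintro ⟨h1, h2⟩ i j hij
    rcases lt_or_ge i.val k with hi | hi
    · rw [h1 i hi, Pi.zero_apply]
    · exact h2 i hi j (by omega)
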